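/- arXiv:math/0507394 — 4 statements merged into one kernel-verified Lean document; each statement's English description precedes it below -/
import Mathlib

section
/- Let (X,r) be a braided set with associated monoid S = S(X,r). Then there exists exactly one matched pair structure on (S,S) satisfying M3 and extending r, in the sense that for all x,y ∈ X the elements ^x y and x^y computed in S equal the images in S of ^x y and x^y computed from r in X. With this structure, (S, r_S) is a braided monoid: the associated map r_S(u,v) = (^u v, u^v) is bijective and satisfies the Yang–Baxter equation on S×S×S. Moreover, r_S is involutive if and only if r is involutive, and r_S is non-degenerate (for every u ∈ S the maps v ↦ ^u v and v ↦ v^u are bijections of S) if and only if r is non-degenerate. -/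
/- Common framework for set-theoretic solutions of the Yang-Baxter equation
   (quadratic sets), following Gateva-Ivanova & Majid. -/

namespace YB

variable {X Y : Type*}

/-- Left action `^x y` : first component of `r (x, y)`. -/
def lact (r : X × X → X × X) (x y : X) : X := (r (x, y)).1

/-- Right action `x ^ y` : second component of `r (x, y)`. -/
def ract (r : X × X → X × X) (x y : X) : X := (r (x, y)).2

def r12 (r : X × X → X × X) : X × X × X → X × X × X :=
  fun p => ((r (p.1, p.2.1)).1, (r (p.1, p.2.1)).2, p.2.2)

def r23 (r : X × X → X × X) : X × X × X → X × X × X :=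
  fun p => (p.1, r (p.2.1, p.2.2))

/-- The Yang-Baxter equation (braided set condition). -/
def IsBraided (r : X × X → X × X) : Prop :=
  r12 r ∘ r23 r ∘ r12 r = r23 r ∘ r12 r ∘ r23 r

/-- l1 : `^x(^y z) = ^(^x y)(^(x^y) z)`. -/
def CondL1 (r : X × X → X × X) : Prop :=
  ∀ x y z : X, lact r x (lact r y z) = lact r (lact r x y) (lact r (ract r x y) z)

/-- r1 : `(x^y)^z = (x^(^y z))^(y^z)`. -/
def CondR1 (r : X × X → X × X) : Prop :=
  ∀ x y z : X, ract r (ract r x y) z = ract r (ract r x (lact r y z)) (ract r y z)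

/-- lr3 : `(^x y)^(^(x^y) z) = ^(x^(^y z))(y^z)`. -/
def CondLR3 (r : X × X → X × X) : Prop :=
  ∀ x y z : X,
    ract r (lact r x y) (lact r (ract r x y) z) =
      lact r (ract r x (lact r y z)) (ract r y z)

/-- Extended left action on pairs : `^x (y,z) = (^x y, ^(x^y) z)`. -/
def lactPair (r : X × X → X × X) (x : X) (p : X × X) : X × X :=
  (lact r x p.1, lact r (ract r x p.1) p.2)

/-- Extended right action on pairs : `(x,y)^z = (x^(^y z), y^z)`. -/
def ractPair (r : X × X → X × X) (p : X × X) (z : X) : X × X :=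
  (ract r p.1 (lact r p.2 z), ract r p.2 z)

/-- l2 : `r (^x (y,z)) = ^x (r (y,z))`. -/
def CondL2 (r : X × X → X × X) : Prop :=
  ∀ x y z : X, r (lactPair r x (y, z)) = lactPair r x (r (y, z))

/-- r2 : `r ((x,y)^z) = (r (x,y))^z`. -/
def CondR2 (r : X × X → X × X) : Prop :=
  ∀ x y z : X, r (ractPair r (x, y) z) = ractPair r (r (x, y)) z

/-- Non-degeneracy: all left actions `L_x` and right actions `R_x` are bijective. -/
def Nondeg (r : X × X → X × X) : Prop :=
  (∀ x : X, Function.Bijective (lact r x)) ∧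
    (∀ x : X, Function.Bijective fun y => ract r y x)

def SquareFree (r : X × X → X × X) : Prop := ∀ x : X, r (x, x) = (x, x)

/-- lri : `(^x y)^x = y = ^x (y^x)`. -/
def CondLRI (r : X × X → X × X) : Prop :=
  ∀ x y : X, ract r (lact r x y) x = y ∧ lact r x (ract r y x) = y

/-- cl1 : `^(y^x) x = ^y x`. -/
def CondCL1 (r : X × X → X × X) : Prop := ∀ x y : X, lact r (ract r y x) x = lact r y x

/-- cr1 : `x^(^x y) = x^y`. -/
def CondCR1 (r : X × X → X × X) : Prop := ∀ x y : X, ract r x (lact r x y) = ract r x y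

/-- cl2 : `^(^x y) x = ^y x`. -/
def CondCL2 (r : X × X → X × X) : Prop := ∀ x y : X, lact r (lact r x y) x = lact r y x

/-- cr2 : `x^(y^x) = x^y`. -/
def CondCR2 (r : X × X → X × X) : Prop := ∀ x y : X, ract r x (ract r y x) = ract r x y

/-- cyclic : all four cyclic conditions. -/
def IsCyclic (r : X × X → X × X) : Prop := CondCL1 r ∧ CondCR1 r ∧ CondCL2 r ∧ CondCR2 r

/-- csl (left cycle set condition) : `^(^y t)(^y x) = ^(^t y)(^t x)`. -/
def CondCSL (r : X × X → X × X) : Prop :=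
  ∀ x y t : X, lact r (lact r y t) (lact r y x) = lact r (lact r t y) (lact r t x)

/-- csr (right cycle set condition) : `(x^y)^(t^y) = (x^t)^(y^t)`. -/
def CondCSR (r : X × X → X × X) : Prop :=
  ∀ x y t : X, ract r (ract r x y) (ract r t y) = ract r (ract r x t) (ract r y t)

def LeftTwoCancellative (r : X × X → X × X) : Prop :=
  ∀ k : ℕ, 1 ≤ k → ∀ x y z : X, r^[k] (x, y) = (x, z) → z = y

def RightTwoCancellative (r : X × X → X × X) : Prop :=
  ∀ k : ℕ, 1 ≤ k → ∀ x y t : X, r^[k] (x, y) = (t, y) → t = x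

def TwoCancellative (r : X × X → X × X) : Prop :=
  LeftTwoCancellative r ∧ RightTwoCancellative r

/-- The defining relations `x y = (^x y)(x^y)` of the monoid `S(X,r)`. -/
def ybRel (r : X × X → X × X) : FreeMonoid X → FreeMonoid X → Prop :=
  fun a b => ∃ x y : X,
    a = FreeMonoid.of x * FreeMonoid.of y ∧
      b = FreeMonoid.of (lact r x y) * FreeMonoid.of (ract r x y)

def ybCon (r : X × X → X × X) : Con (FreeMonoid X) := conGen (ybRel r)

/-- The monoid `S(X,r)` associated with a quadratic set. -/
abbrev YBM (r : X × X → X × X) := (ybCon r).Quotient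

/-- The image in `S(X,r)` of a generator `x ∈ X`. -/
def gen (r : X × X → X × X) (x : X) : YBM r := (ybCon r).mk' (FreeMonoid.of x)

/-- Left cancellation on monomials of length 2 in `S(X,r)`. -/
def LeftCancel2 (r : X × X → X × X) : Prop :=
  ∀ x y z : X, gen r x * gen r y = gen r x * gen r z → y = z

/-- Right cancellation on monomials of length 2 in `S(X,r)`. -/
def RightCancel2 (r : X × X → X × X) : Prop :=
  ∀ x y z : X, gen r y * gen r x = gen r z * gen r x → y = z

/-- Cancellation on monomials of length 3 in `S(X,r)`. -/
def Cancel3 (r : X × X → X × X) : Prop :=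
  (∀ x y z p q : X,
      gen r x * gen r y * gen r z = gen r x * gen r p * gen r q →
        gen r y * gen r z = gen r p * gen r q) ∧
    (∀ x y z p q : X,
      gen r y * gen r z * gen r x = gen r p * gen r q * gen r x →
        gen r y * gen r z = gen r p * gen r q)

/-- A matched pair structure `(S,S)` on a monoid `S` with the M3 property. -/
structure M3Structure (S : Type*) [Monoid S] where
  lact : S → S → S
  ract : S → S → S
  one_lact : ∀ v : S, lact 1 v = v
  mul_lact : ∀ u w v : S, lact (u * w) v = lact u (lact w v)
  ract_one : ∀ u : S, ract u 1 = u
  ract_mul : ∀ u v w : S, ract u (v * w) = ract (ract u v) w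
  lact_one : ∀ u : S, lact u 1 = 1
  one_ract : ∀ v : S, ract 1 v = 1
  lact_mul : ∀ u v w : S, lact u (v * w) = lact u v * lact (ract u v) w
  mul_ract : ∀ u w v : S, ract (u * w) v = ract u (lact w v) * ract w v
  m3 : ∀ u v : S, lact u v * ract u v = u * v

/-- The associated map `r_S (u,v) = (^u v, u^v)` of an M3-monoid. -/
def M3Structure.map {S : Type*} [Monoid S] (M : M3Structure S) : S × S → S × S :=
  fun p => (M.lact p.1 p.2, M.ract p.1 p.2)

/-- The map `σ (α, x) = (^α x, α^x)` built from a pair of ground actions. -/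
def groundMap (gl : Y → X → X) (gr : Y → X → Y) : Y × X → X × Y :=
  fun p => (gl p.1 p.2, gr p.1 p.2)

/-- The regular extension `(Z, r)`, `Z = X ⊔ Y`, of `(X, rX)` and `(Y, rY)` along
ground actions `gl, gr` with `σinv` inverting `σ = groundMap gl gr`. -/
def extMap (rX : X × X → X × X) (rY : Y × Y → Y × Y)
    (gl : Y → X → X) (gr : Y → X → Y) (σinv : X × Y → Y × X) :
    (X ⊕ Y) × (X ⊕ Y) → (X ⊕ Y) × (X ⊕ Y) :=
  fun p =>
    match p with
    | (Sum.inl x, Sum.inl y) => (Sum.inl (rX (x, y)).1, Sum.inl (rX (x, y)).2)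
    | (Sum.inr a, Sum.inr b) => (Sum.inr (rY (a, b)).1, Sum.inr (rY (a, b)).2)
    | (Sum.inr a, Sum.inl x) => (Sum.inl (gl a x), Sum.inr (gr a x))
    | (Sum.inl x, Sum.inr a) => (Sum.inr (σinv (x, a)).1, Sum.inl (σinv (x, a)).2)

/-- ml1 : `^α(^β x) = ^(^α β)(^(α^β) x)`. -/
def CondML1 (rY : Y × Y → Y × Y) (gl : Y → X → X) (gr : Y → X → Y) : Prop :=
  ∀ (α β : Y) (x : X), gl α (gl β x) = gl (lact rY α β) (gl (ract rY α β) x)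

/-- mr1 : `(α^x)^y = (α^(^x y))^(x^y)`. -/
def CondMR1 (rX : X × X → X × X) (gr : Y → X → Y) : Prop :=
  ∀ (α : Y) (x y : X), gr (gr α x) y = gr (gr α (lact rX x y)) (ract rX x y)

/-- ml2 : `rX (^α (x,y)) = ^α (rX (x,y))`. -/
def CondML2 (rX : X × X → X × X) (gl : Y → X → X) (gr : Y → X → Y) : Prop :=
  ∀ (α : Y) (x y : X),
    rX (gl α x, gl (gr α x) y) =
      (gl α (lact rX x y), gl (gr α (lact rX x y)) (ract rX x y))

/-- mr2 : `(rY (α,β))^x = rY ((α,β)^x)`. -/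
def CondMR2 (rY : Y × Y → Y × Y) (gl : Y → X → X) (gr : Y → X → Y) : Prop :=
  ∀ (α β : Y) (x : X),
    (gr (lact rY α β) (gl (ract rY α β) x), gr (ract rY α β) x) =
      rY (gr α (gl β x), gr β x)

/-- ml1a : `^α(^x y) = ^(^α x)(^(α^x) y)`. -/
def CondML1A (rX : X × X → X × X) (gl : Y → X → X) (gr : Y → X → Y) : Prop :=
  ∀ (α : Y) (x y : X),
    gl α (lact rX x y) = lact rX (gl α x) (gl (gr α x) y)

/-- mr1a : `(α^β)^x = (α^(^β x))^(β^x)`. -/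
def CondMR1A (rY : Y × Y → Y × Y) (gl : Y → X → X) (gr : Y → X → Y) : Prop :=
  ∀ (α β : Y) (x : X),
    gr (ract rY α β) x = ract rY (gr α (gl β x)) (gr β x)


section Helpers
universe u

/-- Abstract form of the presentation of `S(X,r)`. -/
structure Pres {X : Type u} (r : X × X → X × X) (S : Type u) [Monoid S] (g : X → S) : Prop where
  rel : ∀ x y, g x * g y = g (lact r x y) * g (ract r x y)
  univ : ∀ (P : Type u) [Monoid P] (f : X → P),
    (∀ x y, f x * f y = f (lact r x y) * f (ract r x y)) → ∃ F : S →* P, ∀ x, F (g x) = f x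
  ind : ∀ P : S → Prop, P 1 → (∀ x u, P u → P (g x * u)) → ∀ u, P u
  indR : ∀ P : S → Prop, P 1 → (∀ u x, P u → P (u * g x)) → ∀ u, P u

theorem pres_YBM {X : Type u} (r : X × X → X × X) : Pres r (YBM r) (gen r) where
  rel x y := by
    have : ybCon r (FreeMonoid.of x * FreeMonoid.of y)
        (FreeMonoid.of (lact r x y) * FreeMonoid.of (ract r x y)) :=
      ConGen.Rel.of _ _ ⟨x, y, rfl, rfl⟩
    exact (Con.eq _).2 this
  univ P _ f h := by
    refine ⟨Con.lift (ybCon r) (FreeMonoid.lift f) ?_, ?_⟩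
    · refine Con.conGen_le.2 ?_
      rintro a b ⟨x, y, rfl, rfl⟩
      simp [Con.ker_rel, h x y]
    · intro x
      exact FreeMonoid.lift_eval_of f x
  ind P h1 hm u := by
    induction u using Con.induction_on with
    | H w =>
      induction w using FreeMonoid.recOn with
      | one => exact h1
      | of_mul x w ih => exact hm x _ ih
  indR P h1 hm u := by
    have key : ∀ w : FreeMonoid X, ∀ v : YBM r, P v → P (v * (ybCon r).mk' w) := by
      intro w
      induction w using FreeMonoid.recOn with
      | one => intro v hv; simpa using hv
      | of_mul x w ih =>
        intro v hv
        have := ih _ (hm v x hv)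
        rw [map_mul, ← mul_assoc]
        exact this
    induction u using Con.induction_on with
    | H w => simpa using key w 1 h1

/-- State-writer functions (state threaded left to right). -/
structure SW (X S : Type u) where
  out : X → S
  st : X → X

@[ext] theorem SW.ext' {X S : Type u} {f g : SW X S} (h : ∀ x, f.out x = g.out x)
    (h' : ∀ x, f.st x = g.st x) : f = g := by
  cases f; cases g
  simp only [SW.mk.injEq]
  exact ⟨funext h, funext h'⟩

instance {X S : Type u} [Monoid S] : Monoid (SW X S) where
  mul f g := ⟨fun x => f.out x * g.out (f.st x), fun x => g.st (f.st x)⟩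
  one := ⟨fun _ => 1, fun x => x⟩
  mul_assoc f g h := SW.ext' (fun _ => mul_assoc _ _ _) (fun _ => rfl)
  one_mul f := SW.ext' (fun _ => one_mul _) (fun _ => rfl)
  mul_one f := SW.ext' (fun _ => mul_one _) (fun _ => rfl)

/-- State-writer functions (state threaded right to left). -/
structure WS (X S : Type u) where
  out : X → S
  st : X → X

theorem WS.ext' {X S : Type u} {f g : WS X S} (h : ∀ x, f.out x = g.out x)
    (h' : ∀ x, f.st x = g.st x) : f = g := by
  cases f; cases g
  simp only [WS.mk.injEq]
  exact ⟨funext h, funext h'⟩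

instance {X S : Type u} [Monoid S] : Monoid (WS X S) where
  mul f g := ⟨fun x => f.out (g.st x) * g.out x, fun x => f.st (g.st x)⟩
  one := ⟨fun _ => 1, fun x => x⟩
  mul_assoc f g h := WS.ext' (fun _ => (mul_assoc _ _ _)) (fun _ => rfl)
  one_mul f := WS.ext' (fun _ => one_mul _) (fun _ => rfl)
  mul_one f := WS.ext' (fun _ => mul_one _) (fun _ => rfl)

theorem braid_eqs {X : Type u} {r : X × X → X × X} (h : IsBraided r) :
    CondL1 r ∧ CondR1 r ∧ CondLR3 r := by
  have H : ∀ x y z, _ := fun x y z => congrFun h (x, y, z)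
  refine ⟨fun x y z => ?_, fun x y z => ?_, fun x y z => ?_⟩
  · exact (congrArg (fun p => p.1) (H x y z)).symm
  · exact (congrArg (fun p => p.2.2) (H x y z))
  · exact (congrArg (fun p => p.2.1) (H x y z))

/-- `M` extends `r` along `g`. -/
def Ext {X : Type u} (r : X × X → X × X) {S : Type u} [Monoid S] (g : X → S)
    (M : M3Structure S) : Prop :=
  ∀ x y : X, M.lact (g x) (g y) = g (lact r x y) ∧ M.ract (g x) (g y) = g (ract r x y)

section
variable {X : Type u} {r : X × X → X × X} {S : Type u} [Monoid S] {g : X → S}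

theorem Pres.exists_lr (hp : Pres r S g) (hbr : IsBraided r) :
    ∃ (l : X → S → S) (q : X → S → X),
      (∀ x, l x 1 = 1) ∧ (∀ x, q x 1 = x) ∧
      (∀ x v w, l x (v * w) = l x v * l (q x v) w) ∧
      (∀ x v w, q x (v * w) = q (q x v) w) ∧
      (∀ x y, l x (g y) = g (lact r x y)) ∧ (∀ x y, q x (g y) = ract r x y) := by
  obtain ⟨L1, R1, LR3⟩ := braid_eqs hbr
  obtain ⟨F, hF⟩ := hp.univ (SW X S) (fun y => ⟨fun x => g (lact r x y), fun x => ract r x y⟩) (by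
    intro y z
    refine SW.ext' (fun x => ?_) (fun x => ?_)
    · change g (lact r x y) * g (lact r (ract r x y) z) =
        g (lact r x (lact r y z)) * g (lact r (ract r x (lact r y z)) (ract r y z))
      rw [hp.rel, ← L1, LR3]
    · exact R1 x y z)
  refine ⟨fun x v => (F v).out x, fun x v => (F v).st x, ?_, ?_, ?_, ?_, ?_, ?_⟩
  · intro x; simp only [map_one]; rfl
  · intro x; simp only [map_one]; rfl
  · intro x v w; simp only [map_mul]; rfl
  · intro x v w; simp only [map_mul]; rfl
  · intro x y; simp only [hF]
  · intro x y; simp only [hF]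

theorem Pres.exists_M3 (hp : Pres r S g) (hbr : IsBraided r) :
    ∃ M : M3Structure S, Ext r g M := by
  obtain ⟨l, q, l1, q1, lm, qm, lg, qg⟩ := hp.exists_lr hbr
  obtain ⟨L1, R1, LR3⟩ := braid_eqs hbr
  have key : ∀ w, ∀ x y, l x (l y w) = l (lact r x y) (l (ract r x y) w) ∧
      lact r (q x (l y w)) (q y w) = q (lact r x y) (l (ract r x y) w) ∧
      ract r (q x (l y w)) (q y w) = q (ract r x y) w := by
    refine hp.ind _ ?_ ?_
    · intro x y; simp [l1, q1]
    · intro z w ih x y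
      obtain ⟨h1, h2, h3⟩ := ih (ract r x (lact r y z)) (ract r y z)
      simp only [lm, qm, lg, qg]
      rw [h1, h2, h3, ← L1, ← R1, ← LR3]
      exact ⟨rfl, rfl, rfl⟩
  obtain ⟨F, hF⟩ := hp.univ (WS S S) (fun x => ⟨fun w => g (q x w), fun w => l x w⟩) (by
    intro x y
    refine WS.ext' (fun w => ?_) (fun w => ?_)
    · change g (q x (l y w)) * g (q y w) = g (q (lact r x y) (l (ract r x y) w)) * g (q (ract r x y) w)
      rw [hp.rel, (key w x y).2.1, (key w x y).2.2]
    · exact (key w x y).1)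
  let A : S → S → S := fun u w => (F u).st w
  let B : S → S → S := fun u w => (F u).out w
  have A1 : ∀ w, A 1 w = w := by intro w; simp only [A, map_one]; rfl
  have B1 : ∀ w, B 1 w = 1 := by intro w; simp only [B, map_one]; rfl
  have Am : ∀ u v w, A (u * v) w = A u (A v w) := by intro u v w; simp only [A, map_mul]; rfl
  have Bm : ∀ u v w, B (u * v) w = B u (A v w) * B v w := by
    intro u v w; simp only [A, B, map_mul]; rfl
  have Ag : ∀ x w, A (g x) w = l x w := by intro x w; simp only [A, hF]
  have Bg : ∀ x w, B (g x) w = g (q x w) := by intro x w; simp only [B, hF]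
  have A1' : ∀ u, A u 1 = 1 := by
    refine hp.ind _ (A1 1) ?_
    intro x u ih
    rw [Am, ih, Ag, l1]
  have B1' : ∀ u, B u 1 = u := by
    refine hp.ind _ (B1 1) ?_
    intro x u ih
    rw [Bm, ih, A1', Bg, q1]
  have AB : ∀ u, ∀ v w, A u (v * w) = A u v * A (B u v) w ∧ B u (v * w) = B (B u v) w := by
    refine hp.ind _ ?_ ?_
    · intro v w; simp [A1, B1]
    · intro x u ih v w
      constructor
      · rw [Am, (ih v w).1, Ag, lm, Bm, Am, Am, Bg, Ag, Ag]
      · rw [Bm, (ih v w).1, (ih v w).2, Bg, qm, Bm _ _ v, Bm _ _ w, Bg, Bg]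
  have M3 : ∀ u v, A u v * B u v = u * v := by
    have gm : ∀ v, ∀ x, l x v * g (q x v) = g x * v := by
      refine hp.ind _ ?_ ?_
      · intro x; simp [l1, q1]
      · intro y v ih x
        rw [lm, qm, mul_assoc, lg, qg, ih, ← mul_assoc, ← hp.rel, mul_assoc]
    refine hp.ind _ ?_ ?_
    · intro v; simp [A1, B1]
    · intro x u ih v
      rw [Am, Bm, Bg, Ag, ← mul_assoc, gm, mul_assoc, ih, mul_assoc]
  exact ⟨⟨A, B, A1, Am, B1', fun u v w => (AB u v w).2, A1', B1, fun u v w => (AB u v w).1,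
    Bm, M3⟩, fun x y => ⟨by rw [← lg]; exact Ag _ _, by rw [← qg]; exact Bg _ _⟩⟩

/-- Induction principle over pairs. -/
theorem Pres.pair_ind (hp : Pres r S g) {M : M3Structure S} (hM : Ext r g M)
    (Q : S → S → Prop) (h1 : ∀ v, Q 1 v) (h1' : ∀ u, Q u 1)
    (hg : ∀ x y, Q (g x) (g y))
    (hl : ∀ a b v, Q a (M.lact b v) → Q b v → Q (a * b) v)
    (hr : ∀ u v w, Q u v → Q (M.ract u v) w → Q u (v * w)) : ∀ u v, Q u v := by
  have s1 : ∀ v, ∀ x, Q (g x) v := by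
    refine hp.ind _ (fun x => h1' _) ?_
    intro y v ih x
    refine hr _ _ _ (hg x y) ?_
    rw [(hM x y).2]
    exact ih _
  exact hp.ind _ h1 (fun x u ih v => hl _ _ _ (s1 _ x) (ih v))

theorem m3_ext {M M' : M3Structure S} (h : ∀ u v, M'.lact u v = M.lact u v ∧
    M'.ract u v = M.ract u v) : M' = M := by
  have h1 : M'.lact = M.lact := funext fun u => funext fun v => (h u v).1
  have h2 : M'.ract = M.ract := funext fun u => funext fun v => (h u v).2
  cases M; cases M'
  simp only at h1 h2
  subst h1; subst h2; rfl

theorem Pres.unique (hp : Pres r S g) {M M' : M3Structure S} (hM : Ext r g M)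
    (hM' : Ext r g M') : M' = M := by
  refine m3_ext (hp.pair_ind hM _ ?_ ?_ ?_ ?_ ?_)
  · intro v; simp [M3Structure.one_lact, M3Structure.one_ract]
  · intro v; simp [M3Structure.lact_one, M3Structure.ract_one]
  · intro x y; rw [(hM x y).1, (hM x y).2]; exact hM' x y
  · intro a b v ⟨h1, h2⟩ ⟨h3, h4⟩
    simp only [M3Structure.mul_lact, M3Structure.mul_ract, h3, h4, h1, h2, and_self]
  · intro a b v ⟨h1, h2⟩ ⟨h3, h4⟩
    simp only [M3Structure.lact_mul, M3Structure.ract_mul, h1, h2, h3, h4, and_self]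

theorem Pres.left_inv {r' : X × X → X × X} (hp : Pres r S g) {M M' : M3Structure S}
    (hM : Ext r g M) (hM' : Ext r' g M') (hrr : ∀ p, r' (r p) = p) (p : S × S) :
    M'.map (M.map p) = p := by
  have : ∀ u v, M'.lact (M.lact u v) (M.ract u v) = u ∧ M'.ract (M.lact u v) (M.ract u v) = v := by
    refine hp.pair_ind hM _ ?_ ?_ ?_ ?_ ?_
    · intro v; simp [M3Structure.one_lact, M3Structure.one_ract, M3Structure.lact_one, M3Structure.ract_one]
    · intro v; simp [M3Structure.one_lact, M3Structure.one_ract, M3Structure.lact_one, M3Structure.ract_one]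
    · intro x y
      rw [(hM x y).1, (hM x y).2, (hM' _ _).1, (hM' _ _).2]
      have := hrr (x, y)
      exact ⟨congrArg g (congrArg Prod.fst this), congrArg g (congrArg Prod.snd this)⟩
    · intro a b v ⟨h1, h2⟩ ⟨h3, h4⟩
      rw [M.mul_lact, M.mul_ract, M'.lact_mul, M'.ract_mul, h1, h2, h3, h4]
      exact ⟨rfl, rfl⟩
    · intro u v w ⟨h1, h2⟩ ⟨h3, h4⟩
      rw [M.lact_mul, M.ract_mul, M'.mul_lact, M'.mul_ract, h3, h4, h1, h2]
      exact ⟨rfl, rfl⟩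
  exact Prod.ext (this p.1 p.2).1 (this p.1 p.2).2

theorem braided_inv {r' : X × X → X × X} (hbr : IsBraided r) (h1 : ∀ p, r' (r p) = p)
    (h2 : ∀ p, r (r' p) = p) : IsBraided r' := by
  have a1 : ∀ p, r12 r' (r12 r p) = p := fun p => by
    rcases p with ⟨x, y, z⟩; simp [r12, h1]
  have a2 : ∀ p, r12 r (r12 r' p) = p := fun p => by
    rcases p with ⟨x, y, z⟩; simp [r12, h2]
  have b1 : ∀ p, r23 r' (r23 r p) = p := fun p => by
    rcases p with ⟨x, y, z⟩; simp [r23, h1]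
  have b2 : ∀ p, r23 r (r23 r' p) = p := fun p => by
    rcases p with ⟨x, y, z⟩; simp [r23, h2]
  funext p
  have h := congrFun hbr (r12 r' (r23 r' (r12 r' p)))
  simp only [Function.comp_apply, a2, b2] at h ⊢
  have h' := congrArg (fun q => r23 r' (r12 r' (r23 r' q))) h
  simp only [a1, b1] at h'
  exact h'.symm

theorem Pres.inv {r' : X × X → X × X} (hp : Pres r S g) (h1 : ∀ p, r' (r p) = p)
    (h2 : ∀ p, r (r' p) = p) : Pres r' S g where
  rel x y := by
    rw [hp.rel (lact r' x y)]
    have h := h2 (x, y)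
    have e1 : lact r (lact r' x y) (ract r' x y) = x := congrArg Prod.fst h
    have e2 : ract r (lact r' x y) (ract r' x y) = y := congrArg Prod.snd h
    rw [e1, e2]
  univ P _ f hf := by
    refine hp.univ P f fun x y => ?_
    rw [hf (lact r x y)]
    have h := h1 (x, y)
    have e1 : lact r' (lact r x y) (ract r x y) = x := congrArg Prod.fst h
    have e2 : ract r' (lact r x y) (ract r x y) = y := congrArg Prod.snd h
    rw [e1, e2]
  ind := hp.ind
  indR := hp.indR

theorem Pres.bij (hp : Pres r S g) (hr : Function.Bijective r) (hbr : IsBraided r)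
    {M : M3Structure S} (hM : Ext r g M) : Function.Bijective M.map := by
  obtain ⟨r', h1, h2⟩ := Function.bijective_iff_has_inverse.1 hr
  have hp' := hp.inv h1 h2
  obtain ⟨M', hM'⟩ := hp'.exists_M3 (braided_inv hbr h1 h2)
  exact Function.bijective_iff_has_inverse.2
    ⟨M'.map, hp.left_inv hM hM' h1, hp'.left_inv hM' hM h2⟩

theorem Pres.lact_gen (hp : Pres r S g) {M : M3Structure S} (hM : Ext r g M) :
    ∀ u x, ∃ y, M.lact u (g x) = g y := by
  refine hp.ind _ (fun x => ⟨x, M.one_lact _⟩) ?_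
  intro z u ih x
  obtain ⟨y, hy⟩ := ih x
  exact ⟨_, by rw [M.mul_lact, hy, (hM z y).1]⟩

theorem Pres.ract_gen (hp : Pres r S g) {M : M3Structure S} (hM : Ext r g M) :
    ∀ u x, ∃ y, M.ract (g x) u = g y := by
  refine hp.ind _ (fun x => ⟨x, M.ract_one _⟩) ?_
  intro z u ih x
  obtain ⟨y, hy⟩ := ih (ract r x z)
  exact ⟨_, by rw [M.ract_mul, (hM x z).2, hy]⟩

theorem M3Structure.l1 (M : M3Structure S) (u v w : S) :
    M.lact (M.lact u v) (M.lact (M.ract u v) w) = M.lact u (M.lact v w) := by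
  rw [← M.mul_lact, M.m3, M.mul_lact]

theorem M3Structure.r1 (M : M3Structure S) (u v w : S) :
    M.ract (M.ract u (M.lact v w)) (M.ract v w) = M.ract (M.ract u v) w := by
  rw [← M.ract_mul, M.m3, M.ract_mul]

theorem Pres.lr3 (hp : Pres r S g) (hbr : IsBraided r) {M : M3Structure S} (hM : Ext r g M) :
    ∀ v u w, M.ract (M.lact u v) (M.lact (M.ract u v) w) =
      M.lact (M.ract u (M.lact v w)) (M.ract v w) := by
  obtain ⟨-, -, LR3⟩ := braid_eqs hbr
  have s1 : ∀ u, ∀ y z, M.ract (M.lact u (g y)) (M.lact (M.ract u (g y)) (g z)) =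
      M.lact (M.ract u (M.lact (g y) (g z))) (M.ract (g y) (g z)) := by
    refine hp.ind _ ?_ ?_
    · intro y z; simp [M.one_lact, M.one_ract]
    · intro x b ih y z
      obtain ⟨y', hy'⟩ := hp.lact_gen hM b y
      obtain ⟨z', hz'⟩ := hp.lact_gen hM (M.ract b (g y)) z
      have e : M.ract (M.lact (g x) (g y')) (M.lact (M.ract (g x) (g y')) (g z')) =
          M.lact (M.ract (g x) (M.lact (g y') (g z'))) (M.ract (g y') (g z')) := by
        simp only [(hM _ _).1, (hM _ _).2, LR3 x y' z']
      rw [← hy', ← hz', ih, M.l1] at e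
      rw [M.mul_lact, M.mul_ract, M.mul_lact, e, M.mul_ract, M.mul_lact]
  have s2 : ∀ w, ∀ u y, M.ract (M.lact u (g y)) (M.lact (M.ract u (g y)) w) =
      M.lact (M.ract u (M.lact (g y) w)) (M.ract (g y) w) := by
    refine hp.ind _ ?_ ?_
    · intro u y; simp [M.lact_one, M.ract_one]
    · intro z w ih u y
      obtain ⟨y', hy'⟩ := hp.ract_gen hM (g z) y
      have e := ih (M.ract u (M.lact (g y) (g z))) y'
      rw [← hy', M.r1] at e
      rw [M.lact_mul, M.ract_mul, s1, e, M.lact_mul, M.ract_mul, M.ract_mul]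
  refine hp.ind _ ?_ ?_
  · intro u w; simp [M.lact_one, M.one_ract]
  · intro a b ih u w
    rw [M.lact_mul, M.mul_ract, M.ract_mul, ih, M.l1, s2, M.mul_lact, M.mul_ract, M.lact_mul,
      M.r1]

theorem Pres.braided (hp : Pres r S g) (hbr : IsBraided r) {M : M3Structure S}
    (hM : Ext r g M) : IsBraided M.map := by
  funext ⟨u, v, w⟩
  exact Prod.ext (M.l1 u v w) (Prod.ext (hp.lr3 hbr hM v u w) (M.r1 u v w).symm)

theorem Pres.bij_lact (hp : Pres r S g) (hbr : IsBraided r) {M : M3Structure S}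
    (hM : Ext r g M) (hn : Nondeg r) (u : S) : Function.Bijective (M.lact u) := by
  obtain ⟨L1, R1, LR3⟩ := braid_eqs hbr
  choose i hi1 hi2 using fun x => Function.bijective_iff_has_inverse.1 (hn.1 x)
  have hi1' : ∀ x y, i x (lact r x y) = y := hi1
  have hi2' : ∀ x y, lact r x (i x y) = y := hi2
  obtain ⟨F, hF⟩ := hp.univ (SW X S) (fun y => ⟨fun x => g (i x y), fun x => ract r x (i x y)⟩) (by
    intro y z
    have H : ∀ x, i x (lact r y z) = lact r (i x y) (i (ract r x (i x y)) z) ∧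
        i (ract r x (i x (lact r y z))) (ract r y z) =
          ract r (i x y) (i (ract r x (i x y)) z) := by
      intro x
      obtain ⟨y', rfl⟩ := (hn.1 x).2 y
      obtain ⟨z', rfl⟩ := (hn.1 (ract r x y')).2 z
      have e : i x (lact r (lact r x y') (lact r (ract r x y') z')) = lact r y' z' := by
        rw [← L1, hi1']
      rw [e, LR3]
      simp only [hi1', and_self]
    refine SW.ext' (fun x => ?_) (fun x => ?_)
    · change g (i x y) * g (i (ract r x (i x y)) z) =
        g (i x (lact r y z)) * g (i (ract r x (i x (lact r y z))) (ract r y z))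
      rw [(H x).1, ← (H x).1, (H x).2, (H x).1, ← hp.rel]
    · change ract r (ract r x (i x y)) (i (ract r x (i x y)) z) =
        ract r (ract r x (i x (lact r y z))) (i (ract r x (i x (lact r y z))) (ract r y z))
      rw [(H x).2, (H x).1, ← R1])
  have F1 : ∀ x, (F 1).out x = 1 := fun x => by simp only [map_one]; rfl
  have Fm : ∀ y v x, (F (g y * v)).out x = g (i x y) * (F v).out (ract r x (i x y)) :=
    fun y v x => by simp only [map_mul, hF]; rfl
  have k1 : ∀ v, ∀ x, (F (M.lact (g x) v)).out x = v := by
    refine hp.ind _ ?_ ?_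
    · intro x; rw [M.lact_one, F1]
    · intro y v ih x
      rw [M.lact_mul, (hM x y).1, (hM x y).2, Fm, hi1', ih]
  have k2 : ∀ v, ∀ x, M.lact (g x) ((F v).out x) = v := by
    refine hp.ind _ ?_ ?_
    · intro x; rw [F1, M.lact_one]
    · intro y v ih x
      rw [Fm, M.lact_mul, (hM _ _).1, (hM _ _).2, ih, hi2']
  revert u
  refine hp.ind _ ?_ ?_
  · rw [show M.lact 1 = id from funext M.one_lact]; exact Function.bijective_id
  · intro x u ih
    rw [show M.lact (g x * u) = M.lact (g x) ∘ M.lact u from funext (M.mul_lact _ _)]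
    exact Function.Bijective.comp (Function.bijective_iff_has_inverse.2
      ⟨fun v => (F v).out x, fun v => k1 v x, fun v => k2 v x⟩) ih

theorem Pres.bij_ract (hp : Pres r S g) (hbr : IsBraided r) {M : M3Structure S}
    (hM : Ext r g M) (hn : Nondeg r) (u : S) : Function.Bijective (fun v => M.ract v u) := by
  obtain ⟨L1, R1, LR3⟩ := braid_eqs hbr
  choose i hi1 hi2 using fun x => Function.bijective_iff_has_inverse.1 (hn.2 x)
  have hi1' : ∀ x y, i x (ract r y x) = y := hi1
  have hi2' : ∀ x y, ract r (i x y) x = y := hi2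
  obtain ⟨F, hF⟩ := hp.univ (WS X S) (fun y => ⟨fun x => g (i x y), fun x => lact r (i x y) x⟩) (by
    intro y z
    have H : ∀ x, i x (ract r y z) = ract r (i (lact r (i x z) x) y) (i x z) ∧
        i (lact r (i x (ract r y z)) x) (lact r y z) =
          lact r (i (lact r (i x z) x) y) (i x z) := by
      intro x
      obtain ⟨z', rfl⟩ := (hn.2 x).2 z
      obtain ⟨y', rfl⟩ := (hn.2 (lact r z' x)).2 y
      have e : i x (ract r (ract r y' (lact r z' x)) (ract r z' x)) = ract r y' z' := by
        rw [← R1, hi1']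
      simp only []
      rw [e, ← LR3]
      simp only [hi1', and_self]
    refine WS.ext' (fun x => ?_) (fun x => ?_)
    · change g (i (lact r (i x z) x) y) * g (i x z) =
        g (i (lact r (i x (ract r y z)) x) (lact r y z)) * g (i x (ract r y z))
      rw [(H x).2, (H x).1, ← hp.rel]
    · change lact r (i (lact r (i x z) x) y) (lact r (i x z) x) =
        lact r (i (lact r (i x (ract r y z)) x) (lact r y z)) (lact r (i x (ract r y z)) x)
      rw [(H x).2, (H x).1, ← L1])
  have F1 : ∀ x, (F 1).out x = 1 := fun x => by simp only [map_one]; rfl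
  have Fm : ∀ v y x, (F (v * g y)).out x = (F v).out (lact r (i x y) x) * g (i x y) :=
    fun y v x => by simp only [map_mul, hF]; rfl
  have k1 : ∀ v, ∀ x, (F (M.ract v (g x))).out x = v := by
    refine hp.indR _ ?_ ?_
    · intro x; rw [M.one_ract, F1]
    · intro v y ih x
      rw [M.mul_ract, (hM y x).1, (hM y x).2, Fm, hi1', ih]
  have k2 : ∀ v, ∀ x, M.ract ((F v).out x) (g x) = v := by
    refine hp.indR _ ?_ ?_
    · intro x; rw [F1, M.one_ract]
    · intro v y ih x
      rw [Fm, M.mul_ract, (hM _ _).1, (hM _ _).2, ih, hi2']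
  revert u
  refine hp.ind _ ?_ ?_
  · rw [show (fun v => M.ract v 1) = id from funext M.ract_one]; exact Function.bijective_id
  · intro x u ih
    rw [show (fun v => M.ract v (g x * u)) = (fun v => M.ract v u) ∘ (fun v => M.ract v (g x))
      from funext (fun v => M.ract_mul _ _ _)]
    exact Function.Bijective.comp ih (Function.bijective_iff_has_inverse.2
      ⟨fun v => (F v).out x, fun v => k1 v x, fun v => k2 v x⟩)

end

/-- Congruence separating generators. -/
def sepCon (X : Type u) : Con (FreeMonoid X) where
  r a b := a = b ∨ (2 ≤ a.length ∧ 2 ≤ b.length)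
  iseqv := ⟨fun _ => Or.inl rfl, fun h => h.elim (fun h => Or.inl h.symm) (fun h => Or.inr h.symm),
    fun {a b c} h h' => by
      rcases h with rfl | h
      · exact h'
      · rcases h' with rfl | h'
        · exact Or.inr h
        · exact Or.inr ⟨h.1, h'.2⟩⟩
  mul' := fun {a b c d} h h' => by
    rcases h with rfl | h
    · rcases h' with rfl | h'
      · exact Or.inl rfl
      · right; simp only [FreeMonoid.length_mul]; omega
    · right
      rcases h' with rfl | h' <;> simp only [FreeMonoid.length_mul] <;> omega

theorem gen_injective {X : Type u} (r : X × X → X × X) : Function.Injective (gen r) := by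
  intro x y h
  have h1 : ybCon r (FreeMonoid.of x) (FreeMonoid.of y) := (Con.eq _).1 h
  have h2 : ybCon r ≤ sepCon X := by
    refine Con.conGen_le.2 ?_
    rintro a b ⟨x, y, rfl, rfl⟩
    right
    simp [FreeMonoid.length_mul]
  rcases h2 h1 with h | h
  · exact FreeMonoid.of_injective h
  · simp at h

/-- Any left factor through a nontrivial element: elements are `1`, a generator or decomposable. -/
theorem exists_len {X : Type u} (r : X × X → X × X) :
    ∃ F : YBM r → ℕ, F 1 = 0 ∧ (∀ u v, F (u * v) = F u + F v) ∧ (∀ x, F (gen r x) = 1) ∧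
      ∀ u, F u = 1 → ∃ x, u = gen r x := by
  have hp := pres_YBM r
  obtain ⟨F, hF⟩ := hp.univ (ULift (Multiplicative ℕ)) (fun _ => ⟨Multiplicative.ofAdd 1⟩)
    (fun _ _ => rfl)
  let G : YBM r → ℕ := fun u => Multiplicative.toAdd (F u).down
  have G1 : G 1 = 0 := by simp only [G, map_one]; rfl
  have Gm : ∀ u v, G (u * v) = G u + G v := fun u v => by simp only [G, map_mul]; rfl
  have Gg : ∀ x, G (gen r x) = 1 := fun x => by simp only [G, hF]; rfl
  have z : ∀ u, G u = 0 → u = 1 := by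
    refine hp.ind _ (fun _ => rfl) ?_
    intro x u _ h
    rw [Gm, Gg] at h; omega
  refine ⟨G, G1, Gm, Gg, ?_⟩
  refine hp.ind _ (fun h => by omega) ?_
  intro x u _ h
  rw [Gm, Gg] at h
  exact ⟨x, by rw [z u (by omega), mul_one]⟩

theorem len_act {X : Type u} {r : X × X → X × X} {M : M3Structure (YBM r)}
    (hM : Ext r (gen r) M) (F : YBM r → ℕ) (F1 : F 1 = 0) (Fm : ∀ u v, F (u * v) = F u + F v)
    (Fg : ∀ x, F (gen r x) = 1) : ∀ u v, F (M.lact u v) = F v ∧ F (M.ract u v) = F u := by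
  refine (pres_YBM r).pair_ind hM _ ?_ ?_ ?_ ?_ ?_
  · intro v; simp [M.one_lact, M.one_ract]
  · intro v; simp [M.lact_one, M.ract_one]
  · intro x y; rw [(hM x y).1, (hM x y).2]; simp [Fg]
  · intro a b v h1 h2
    rw [M.mul_lact, M.mul_ract, Fm, Fm]; omega
  · intro a b v h1 h2
    rw [M.lact_mul, M.ract_mul, Fm, Fm]; omega

end Helpers

/-- Theorems 3.6 and 3.14: for a braided set `(X,r)`, the monoid
`S = S(X,r)` carries a unique M3 matched pair structure extending `r`; the
associated map `r_S` is bijective and obeys the YBE, is involutive iff `r` is,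
and is non-degenerate iff `r` is. -/
theorem braided_monoid_of_braided_set {X : Type*} [Nonempty X]
    (r : X × X → X × X) (hr : Function.Bijective r) (hbr : IsBraided r) :
    ∃ M : M3Structure (YBM r),
      (∀ x y : X,
          M.lact (gen r x) (gen r y) = gen r (lact r x y) ∧
            M.ract (gen r x) (gen r y) = gen r (ract r x y)) ∧
      (∀ M' : M3Structure (YBM r),
          (∀ x y : X,
              M'.lact (gen r x) (gen r y) = gen r (lact r x y) ∧
                M'.ract (gen r x) (gen r y) = gen r (ract r x y)) →
          M' = M) ∧
      Function.Bijective M.map ∧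
      IsBraided M.map ∧
      (Function.Involutive M.map ↔ Function.Involutive r) ∧
      (((∀ u : YBM r, Function.Bijective (M.lact u)) ∧
          (∀ u : YBM r, Function.Bijective fun v => M.ract v u)) ↔
        Nondeg r) := by
  have hp := pres_YBM r
  have gi := gen_injective r
  obtain ⟨M, hM⟩ := hp.exists_M3 hbr
  refine ⟨M, hM, fun M' hM' => hp.unique hM hM', hp.bij hr hbr hM, hp.braided hbr hM,
    ⟨fun h p => ?_, fun h p => hp.left_inv hM hM h p⟩, ⟨fun h => ?_, fun h =>
      ⟨hp.bij_lact hbr hM h, hp.bij_ract hbr hM h⟩⟩⟩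
  · obtain ⟨x, y⟩ := p
    have e := h (gen r x, gen r y)
    simp only [M3Structure.map, (hM _ _).1, (hM _ _).2, Prod.mk.injEq] at e
    exact Prod.ext (gi e.1) (gi e.2)
  · obtain ⟨F, F1, Fm, Fg, Fx⟩ := exists_len r
    have hlen := len_act hM F F1 Fm Fg
    refine ⟨fun x => ⟨fun y z e => ?_, fun y => ?_⟩, fun x => ⟨fun y z e => ?_, fun y => ?_⟩⟩
    · apply gi
      apply (h.1 (gen r x)).1
      rw [(hM _ _).1, (hM _ _).1, e]
    · obtain ⟨v, hv⟩ := (h.1 (gen r x)).2 (gen r y)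
      obtain ⟨z, rfl⟩ := Fx v (by rw [← (hlen (gen r x) v).1, hv, Fg])
      exact ⟨z, gi (by rw [← (hM _ _).1, hv])⟩
    · apply gi
      apply (h.2 (gen r x)).1
      change M.ract _ _ = M.ract _ _
      rw [(hM _ _).2, (hM _ _).2]
      exact congrArg _ e
    · obtain ⟨v, hv⟩ := (h.2 (gen r x)).2 (gen r y)
      obtain ⟨z, rfl⟩ := Fx v (by rw [← (hlen v (gen r x)).2]; exact (congrArg F hv).trans (Fg y))
      exact ⟨z, gi (by rw [← (hM _ _).2]; exact hv)⟩


end YB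
end

section
/- Let (X,r_X) and (Y,r_Y) be disjoint braided sets, let (^α x, α^x) be a regular pair of ground actions, and let (Z,r) be the corresponding regular extension. Then (Z,r) is a braided set (r obeys the Yang–Baxter equation on Z×Z×Z) if and only if the four mixed conditions ml1, mr1, ml2 and mr2 hold. -/
/- Common framework for set-theoretic solutions of the Yang-Baxter equation
   (quadratic sets), following Gateva-Ivanova & Majid. -/

namespace YB

variable {X Y : Type*}

/-- Theorem 4.10: a regular extension `(Z,r)` of disjoint braided
sets `(X,rX)` and `(Y,rY)` obeys the YBE iff ml1, mr1, ml2 and mr2 hold. -/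
theorem regular_extension_braided_iff {X Y : Type*} [Nonempty X] [Nonempty Y]
    (rX : X × X → X × X) (rY : Y × Y → Y × Y)
    (hrX : Function.Bijective rX) (hrY : Function.Bijective rY)
    (hbX : IsBraided rX) (hbY : IsBraided rY)
    (gl : Y → X → X) (gr : Y → X → Y) (σinv : X × Y → Y × X)
    (hinv1 : Function.LeftInverse σinv (groundMap gl gr))
    (hinv2 : Function.RightInverse σinv (groundMap gl gr)) :
    IsBraided (extMap rX rY gl gr σinv) ↔
      (CondML1 rY gl gr ∧ CondMR1 rX gr ∧ CondML2 rX gl gr ∧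
        CondMR2 rY gl gr) := by
  have hs1 : ∀ b z, σinv (gl b z, gr b z) = (b, z) := fun b z => hinv1 (b, z)
  have hs2 : ∀ x a, ∃ b z, x = gl b z ∧ a = gr b z := by
    intro x a
    have h := hinv2 (x, a)
    refine ⟨(σinv (x, a)).1, (σinv (x, a)).2, ?_, ?_⟩
    · exact (congrArg Prod.fst h).symm
    · exact (congrArg Prod.snd h).symm
  constructor
  · intro h
    have h1 := fun (α : Y) (x y : X) => congrFun h (Sum.inr α, Sum.inl x, Sum.inl y)
    have h2 := fun (α β : Y) (x : X) => congrFun h (Sum.inr α, Sum.inr β, Sum.inl x)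
    simp only [r12, r23, extMap, Function.comp, Prod.mk.injEq, Sum.inl.injEq,
      Sum.inr.injEq] at h1 h2
    refine ⟨fun α β x => (h2 α β x).1.symm, fun α x y => (h1 α x y).2.2,
      fun α x y => Prod.ext (h1 α x y).1 (h1 α x y).2.1,
      fun α β x => Prod.ext (h2 α β x).2.1 (h2 α β x).2.2⟩
  · rintro ⟨m1, m2, m3, m4⟩
    simp only [CondML1, CondMR1, CondML2, CondMR2, lact, ract] at m1 m2 m3 m4
    funext ⟨p, q, t⟩
    rcases p with x | a <;> rcases q with y | b <;> rcases t with z | c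
    · have h := congrFun hbX (x, y, z)
      simp only [r12, r23, Function.comp, Prod.ext_iff] at h
      simp only [r12, r23, extMap, Function.comp, h]
    · obtain ⟨b, z, rfl, rfl⟩ := hs2 y c
      obtain ⟨d, w, rfl, rfl⟩ := hs2 x b
      simp only [r12, r23, extMap, Function.comp, hs1, m3]
      simp only [m2 d w z, hs1]
    · obtain ⟨d, w, rfl, rfl⟩ := hs2 x b
      simp only [r12, r23, extMap, Function.comp, hs1, m3, m2 d w z]
    · obtain ⟨d, w, rfl, rfl⟩ := hs2 x b
      obtain ⟨e, v, rfl, rfl⟩ := hs2 w c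
      simp only [r12, r23, extMap, Function.comp, hs1, ← m4]
      simp only [m1 d e v, hs1]
    · simp only [r12, r23, extMap, Function.comp, m3, m2 a y z]
    · obtain ⟨d, w, rfl, rfl⟩ := hs2 y c
      simp only [r12, r23, extMap, Function.comp, hs1, ← m4, m1 a d w]
    · simp only [r12, r23, extMap, Function.comp, ← m4, m1 a b z]
    · have h := congrFun hbY (a, b, c)
      simp only [r12, r23, Function.comp, Prod.ext_iff] at h
      simp only [r12, r23, extMap, Function.comp, h]


end YB
end

section
/- Let (X,r_X) and (Y,r_Y) be disjoint 2-cancellative braided sets, let (^α x, α^x) be a regular pair of ground actions, let (Z,r) be the corresponding regular extension, and suppose that the monoid U = S(Z,r) has cancellation on monomials of length 3. Then (Z,r) is a braided set (r obeys the Yang–Baxter equation) if and only if the conditions ml1, mr1, ml1a and mr1a hold. -/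
/- Common framework for set-theoretic solutions of the Yang-Baxter equation
   (quadratic sets), following Gateva-Ivanova & Majid. -/

namespace YB

variable {X Y : Type*}

/-- Invariant of mixed pairs. -/
def mixN (σinv : X × Y → Y × X) : List (X ⊕ Y) → Option (Y × X)
  | [Sum.inl x, Sum.inr a] => some (σinv (x, a))
  | [Sum.inr a, Sum.inl x] => some (a, x)
  | _ => none

theorem mixN_long (σinv : X × Y → Y × X) (u : List (X ⊕ Y)) (h : 3 ≤ u.length) :
    mixN σinv u = none := by
  match u, h with
  | a :: b :: c :: t, _ => cases a <;> cases b <;> rfl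

def mixR (σinv : X × Y → Y × X) (u v : List (X ⊕ Y)) : Prop :=
  u = v ∨ (2 ≤ u.length ∧ 2 ≤ v.length ∧ mixN σinv u = mixN σinv v)

theorem mixR_mul (σinv : X × Y → Y × X) (u u' v v' : List (X ⊕ Y))
    (h1 : mixR σinv u u') (h2 : mixR σinv v v') : mixR σinv (u ++ v) (u' ++ v') := by
  have key : ∀ w w' : List (X ⊕ Y), 3 ≤ w.length → 3 ≤ w'.length → mixR σinv w w' := by
    intro w w' h h'
    exact Or.inr ⟨by omega, by omega, by rw [mixN_long _ _ h, mixN_long _ _ h']⟩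
  rcases h1 with rfl | ⟨a1, a2, a3⟩
  · rcases h2 with rfl | ⟨b1, b2, b3⟩
    · exact Or.inl rfl
    · rcases u with _ | ⟨c, t⟩
      · exact Or.inr ⟨b1, b2, b3⟩
      · apply key <;> simp <;> omega
  · rcases h2 with rfl | ⟨b1, b2, b3⟩
    · rcases v with _ | ⟨c, t⟩
      · rw [List.append_nil, List.append_nil]; exact Or.inr ⟨a1, a2, a3⟩
      · apply key <;> simp <;> omega
    · apply key <;> simp <;> omega

section
variable (rX : X × X → X × X) (rY : Y × Y → Y × Y)
    (gl : Y → X → X) (gr : Y → X → Y) (σinv : X × Y → Y × X)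

theorem mixR_of_rel (hinv1 : Function.LeftInverse σinv (groundMap gl gr))
    (u v : FreeMonoid (X ⊕ Y))
    (h : ConGen.Rel (ybRel (extMap rX rY gl gr σinv)) u v) :
    mixR σinv u.toList v.toList := by
  induction h with
  | of u v h =>
    obtain ⟨x, y, rfl, rfl⟩ := h
    right
    refine ⟨by simp, by simp, ?_⟩
    rcases x with x | a <;> rcases y with y | b
    · rfl
    · rfl
    · exact congrArg some (hinv1 (a, y)).symm
    · rfl
  | refl u => exact Or.inl rfl
  | symm _ ih =>
    rcases ih with h | ⟨a, b, c⟩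
    · exact Or.inl h.symm
    · exact Or.inr ⟨b, a, c.symm⟩
  | trans _ _ ih1 ih2 =>
    rcases ih1 with h | ⟨a, b, c⟩
    · rw [h]; exact ih2
    · rcases ih2 with h | ⟨a', b', c'⟩
      · rw [← h]; exact Or.inr ⟨a, b, c⟩
      · exact Or.inr ⟨a, b', c.trans c'⟩
  | mul _ _ ih1 ih2 => exact mixR_mul _ _ _ _ _ ih1 ih2

theorem mix_inj (hinv1 : Function.LeftInverse σinv (groundMap gl gr))
    (hinv2 : Function.RightInverse σinv (groundMap gl gr)) (x x' : X) (a a' : Y)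
    (h : gen (extMap rX rY gl gr σinv) (Sum.inl x) * gen (extMap rX rY gl gr σinv) (Sum.inr a)
      = gen (extMap rX rY gl gr σinv) (Sum.inl x') *
        gen (extMap rX rY gl gr σinv) (Sum.inr a')) : x = x' ∧ a = a' := by
  have h1 := (Con.eq (ybCon (extMap rX rY gl gr σinv))
    (a := FreeMonoid.of (Sum.inl x) * FreeMonoid.of (Sum.inr a))
    (b := FreeMonoid.of (Sum.inl x') * FreeMonoid.of (Sum.inr a'))).1 h
  have h2 := mixR_of_rel rX rY gl gr σinv hinv1 _ _ h1
  rcases h2 with h | ⟨_, _, h⟩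
  · change [Sum.inl x, Sum.inr a] = [Sum.inl x', Sum.inr a'] at h
    simpa using h
  · change some (σinv (x, a)) = some (σinv (x', a')) at h
    have := hinv2.injective (Option.some.inj h)
    simpa using this
end

theorem gen_rel {Z : Type*} (r : Z × Z → Z × Z) (a b c d : Z) (h : r (a, b) = (c, d)) :
    gen r a * gen r b = gen r c * gen r d := by
  have : (ybCon r) (FreeMonoid.of a * FreeMonoid.of b) (FreeMonoid.of c * FreeMonoid.of d) :=
    ConGen.Rel.of _ _ ⟨a, b, rfl, by simp [lact, ract, h]⟩
  exact (Con.eq _).2 this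

theorem gen_braid {Z : Type*} (r : Z × Z → Z × Z) (p : Z × Z × Z) :
    (gen r p.1 * gen r p.2.1 * gen r p.2.2 =
      gen r (r12 r p).1 * gen r (r12 r p).2.1 * gen r (r12 r p).2.2) ∧
    (gen r p.1 * gen r p.2.1 * gen r p.2.2 =
      gen r (r23 r p).1 * gen r (r23 r p).2.1 * gen r (r23 r p).2.2) := by
  constructor
  · simp only [r12]
    rw [gen_rel r p.1 p.2.1 _ _ rfl]
  · simp only [r23]
    rw [mul_assoc, gen_rel r p.2.1 p.2.2 _ _ rfl, mul_assoc]

theorem gen_both {Z : Type*} (r : Z × Z → Z × Z) (p q q' : Z × Z × Z)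
    (h : r12 r (r23 r (r12 r p)) = q) (h' : r23 r (r12 r (r23 r p)) = q') :
    gen r q.1 * gen r q.2.1 * gen r q.2.2 = gen r q'.1 * gen r q'.2.1 * gen r q'.2.2 := by
  subst h h'
  rw [← (gen_braid r _).1, ← (gen_braid r _).2, ← (gen_braid r _).1,
    ← (gen_braid r _).2, ← (gen_braid r _).1, ← (gen_braid r _).2]

/-- Theorem 4.13: if `(X,rX)` and `(Y,rY)` are 2-cancellative
braided sets and the monoid `U = S(Z,r)` of the regular extension cancels on
monomials of length 3, then `(Z,r)` obeys the YBE iff ml1, mr1, ml1a, mr1a. -/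
theorem regular_extension_cancellative_braided_iff {X Y : Type*}
    [Nonempty X] [Nonempty Y]
    (rX : X × X → X × X) (rY : Y × Y → Y × Y)
    (hrX : Function.Bijective rX) (hrY : Function.Bijective rY)
    (hbX : IsBraided rX) (hbY : IsBraided rY)
    (h2cX : TwoCancellative rX) (h2cY : TwoCancellative rY)
    (gl : Y → X → X) (gr : Y → X → Y) (σinv : X × Y → Y × X)
    (hinv1 : Function.LeftInverse σinv (groundMap gl gr))
    (hinv2 : Function.RightInverse σinv (groundMap gl gr))
    (h3c : Cancel3 (extMap rX rY gl gr σinv)) :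
    IsBraided (extMap rX rY gl gr σinv) ↔
      (CondML1 rY gl gr ∧ CondMR1 rX gr ∧ CondML1A rX gl gr ∧
        CondMR1A rY gl gr) := by
  have hs1 : ∀ a x, σinv (gl a x, gr a x) = (a, x) := fun a x => hinv1 (a, x)
  have hs2 : ∀ x a, ∃ b y, x = gl b y ∧ a = gr b y := by
    intro x a
    refine ⟨(σinv (x, a)).1, (σinv (x, a)).2, ?_⟩
    have := hinv2 (x, a)
    simp only [groundMap, Prod.mk.injEq] at this
    exact ⟨this.1.symm, this.2.symm⟩
  constructor
  · intro h
    have H := fun p => congrFun h p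
    refine ⟨fun a b x => ?_, fun a x y => ?_, fun a x y => ?_, fun a b x => ?_⟩
    · have := H (Sum.inr a, Sum.inr b, Sum.inl x)
      simp [r12, r23, extMap] at this
      simp [lact, ract, this.1]
    · have := H (Sum.inr a, Sum.inl x, Sum.inl y)
      simp [r12, r23, extMap] at this
      simp [lact, ract, this.2.2]
    · have := H (Sum.inr a, Sum.inl x, Sum.inl y)
      simp [r12, r23, extMap] at this
      simp [lact, this.1]
    · have := H (Sum.inr a, Sum.inr b, Sum.inl x)
      simp [r12, r23, extMap] at this
      simp [ract, this.2.2]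
  · rintro ⟨h1, h2, h3, h4⟩
    have ml2 : CondML2 rX gl gr := by
      intro a x y
      have e := gen_both (extMap rX rY gl gr σinv) (Sum.inr a, Sum.inl x, Sum.inl y) _ _ rfl rfl
      have e1 := h2 a x y
      have e2 := h3 a x y
      simp only [lact, ract] at e1 e2
      simp only [r12, r23, extMap] at e
      rw [← e1, ← e2, mul_assoc, mul_assoc, ← mul_assoc, ← mul_assoc] at e
      have e3 := mix_inj rX rY gl gr σinv hinv1 hinv2 _ _ _ _ (h3c.1 _ _ _ _ _ e)
      simp only [lact, ract]
      exact Prod.ext e2.symm e3.1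
    have mr2 : CondMR2 rY gl gr := by
      intro a b x
      have e := gen_both (extMap rX rY gl gr σinv) (Sum.inr a, Sum.inr b, Sum.inl x) _ _ rfl rfl
      have e1 := h1 a b x
      have e2 := h4 a b x
      simp only [lact, ract] at e1 e2
      simp only [r12, r23, extMap] at e
      rw [← e1, ← e2] at e
      have e3 := mix_inj rX rY gl gr σinv hinv1 hinv2 _ _ _ _ (h3c.2 _ _ _ _ _ e)
      simp only [lact, ract]
      exact Prod.ext e3.2 e2
    have HX := fun p => congrFun hbX p
    have HY := fun p => congrFun hbY p
    simp only [CondML1, CondMR1, CondML2, CondMR2, lact, ract] at h1 h2 ml2 mr2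
    funext ⟨p, q, t⟩
    rcases p with x | a <;> rcases q with y | b <;> rcases t with z | c
    · have := HX (x, y, z)
      simp only [r12, r23, Function.comp, Prod.ext_iff] at this
      simp [r12, r23, extMap, this.1, this.2.1, this.2.2]
    · obtain ⟨b, y, rfl, rfl⟩ := hs2 y c
      obtain ⟨a, x, rfl, rfl⟩ := hs2 x b
      have e := hs1 (gr a x) y
      rw [h2] at e
      simp [r12, r23, extMap, hs1, ml2, h2 a x y, e]
    · obtain ⟨a, x, rfl, rfl⟩ := hs2 x b
      have := ml2 a x z
      simp [r12, r23, extMap, hs1, ml2, h2 a x z]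
    · obtain ⟨b, x, rfl, rfl⟩ := hs2 x b
      obtain ⟨c, x, rfl, rfl⟩ := hs2 x c
      have e := hs1 b (gl c x)
      rw [h1] at e
      simp [r12, r23, extMap, hs1, ← mr2, h1 b c x, e]
    · simp [r12, r23, extMap, hs1, ml2, h2 a y z]
    · obtain ⟨c, x, rfl, rfl⟩ := hs2 y c
      simp [r12, r23, extMap, hs1, ← mr2, h1 a c x]
    · simp [r12, r23, extMap, hs1, ← mr2, h1 a b z]
    · have := HY (a, b, c)
      simp only [r12, r23, Function.comp, Prod.ext_iff] at this
      simp [r12, r23, extMap, this.1, this.2.1, this.2.2]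

end YB
end

section
/- Let (X,r) be a braided set. Form two disjoint copies of X, written X and X̄, and take as ground actions of X̄ on X the actions of r itself, i.e. σ(x̄, y) := (^x y, (x^y)bar), which is a bijection X̄×X → X×X̄ since r is bijective. Let (X ⊔ X̄, r_D) be the corresponding regular extension (so r_D equals r on each of the two copies, r_D = σ on X̄×X, and r_D = σ^{-1} on X×X̄). Then (X ⊔ X̄, r_D) is a braided set. -/
/- Common framework for set-theoretic solutions of the Yang-Baxter equation
   (quadratic sets), following Gateva-Ivanova & Majid. -/

namespace YB

variable {X Y : Type*}

/-- Corollary 4.11: the `double' `(X ⊔ X̄, r_D)` of a braided set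
`(X,r)`, the regular extension of two copies of `(X,r)` with ground actions
those of `r` itself (and `r⁻¹` on `X × X̄`), is again a braided set. -/
theorem double_braided_set {X : Type*} [Nonempty X]
    (r : X × X → X × X) (rinv : X × X → X × X)
    (h1 : Function.LeftInverse rinv r) (h2 : Function.RightInverse rinv r)
    (hbr : IsBraided r) :
    IsBraided (extMap r r (lact r) (ract r) rinv) := by
  have Aa : ∀ p, r12 r (r12 rinv p) = p := by
    rintro ⟨x, y, z⟩; simp [r12, h2 (x, y)]
  have aA : ∀ p, r12 rinv (r12 r p) = p := by
    rintro ⟨x, y, z⟩; simp [r12, h1 (x, y)]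
  have Bb : ∀ p, r23 r (r23 rinv p) = p := by
    rintro ⟨x, y, z⟩; simp [r23, h2 (y, z)]
  have bB : ∀ p, r23 rinv (r23 r p) = p := by
    rintro ⟨x, y, z⟩; simp [r23, h1 (y, z)]
  have E : ∀ p, r12 r (r23 r (r12 r p)) = r23 r (r12 r (r23 r p)) := fun p => congrFun hbr p
  -- the needed rearrangements of the braid relation
  have XYX : ∀ p, r12 r (r23 r (r12 rinv p)) = r23 rinv (r12 r (r23 r p)) := fun p => by
    have h := E (r12 rinv p)
    rw [Aa] at h
    rw [← bB (r12 r (r23 r (r12 rinv p))), ← h]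
  have YXY : ∀ p, r12 rinv (r23 r (r12 r p)) = r23 r (r12 r (r23 rinv p)) := fun p => by
    have h := E (r23 rinv p)
    rw [Bb] at h
    rw [← aA (r23 r (r12 r (r23 rinv p))), h]
  have XYY : ∀ p, r12 r (r23 rinv (r12 rinv p)) = r23 rinv (r12 rinv (r23 r p)) := fun p => by
    have h := YXY (r12 rinv p)
    rw [Aa] at h
    rw [h, bB]
  have XXY : ∀ p, r12 rinv (r23 rinv (r12 r p)) = r23 r (r12 rinv (r23 rinv p)) := fun p => by
    have h := XYX (r23 rinv p)
    rw [Bb] at h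
    rw [← h, aA]
  funext p
  obtain ⟨x | x, y | y, z | z⟩ := p
  · exact congrArg (fun u : X × X × X =>
      ((Sum.inl u.1 : X ⊕ X), (Sum.inl u.2.1 : X ⊕ X), (Sum.inl u.2.2 : X ⊕ X))) (E (x, y, z))
  · exact congrArg (fun u : X × X × X =>
      ((Sum.inr u.1 : X ⊕ X), (Sum.inl u.2.1 : X ⊕ X), (Sum.inl u.2.2 : X ⊕ X))) (XXY (x, y, z))
  · exact congrArg (fun u : X × X × X =>
      ((Sum.inl u.1 : X ⊕ X), (Sum.inr u.2.1 : X ⊕ X), (Sum.inl u.2.2 : X ⊕ X))) (XYX (x, y, z))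
  · exact congrArg (fun u : X × X × X =>
      ((Sum.inr u.1 : X ⊕ X), (Sum.inr u.2.1 : X ⊕ X), (Sum.inl u.2.2 : X ⊕ X))) (XYY (x, y, z))
  · exact congrArg (fun u : X × X × X =>
      ((Sum.inl u.1 : X ⊕ X), (Sum.inl u.2.1 : X ⊕ X), (Sum.inr u.2.2 : X ⊕ X))) (E (x, y, z))
  · exact congrArg (fun u : X × X × X =>
      ((Sum.inr u.1 : X ⊕ X), (Sum.inl u.2.1 : X ⊕ X), (Sum.inr u.2.2 : X ⊕ X))) (YXY (x, y, z))
  · exact congrArg (fun u : X × X × X =>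
      ((Sum.inl u.1 : X ⊕ X), (Sum.inr u.2.1 : X ⊕ X), (Sum.inr u.2.2 : X ⊕ X))) (E (x, y, z))
  · exact congrArg (fun u : X × X × X =>
      ((Sum.inr u.1 : X ⊕ X), (Sum.inr u.2.1 : X ⊕ X), (Sum.inr u.2.2 : X ⊕ X))) (E (x, y, z))

end YB
end
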